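/- For each policy π = (μ_0, μ_1, …) there exist universally measurable functions f_n : [0,1] × H_n → 𝔸, n ≥ 0, such that for all h_n ∈ H_n: f_n(θ, h_n) ∈ A(x_n) for every θ ∈ [0,1], and μ_n(da_n | h_n) equals the image measure of Lebesgue measure on [0,1] under the map θ ↦ f_n(θ, h_n). -/

import Mathlib

open MeasureTheory ProbabilityTheory Filter
open scoped ENNReal NNReal Topology

noncomputable section

namespace PaperStmt

/-- The Borel σ-algebra of the topology of weak convergence on the space of Borel
probability measures. -/
instance instMeasProb {Ω : Type*} [MeasurableSpace Ω] [TopologicalSpace Ω]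
    [OpensMeasurableSpace Ω] : MeasurableSpace (ProbabilityMeasure Ω) := borel _

/-- A set is universally measurable if it is measurable with respect to the completion of
every Borel probability measure. -/
def UniversallyMeasurableSet {α : Type*} [MeasurableSpace α] (s : Set α) : Prop :=
  ∀ μ : Measure α, IsProbabilityMeasure μ → NullMeasurableSet s μ

/-- A map between measurable spaces is universally measurable if preimages of measurable
sets are universally measurable. -/
def UniversallyMeasurable {α β : Type*} [MeasurableSpace α] [MeasurableSpace β]
    (f : α → β) : Prop :=
  ∀ s : Set β, MeasurableSet s → UniversallyMeasurableSet (f ⁻¹' s)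

/-- A function into the extended reals is lower semianalytic if all its sublevel sets are
analytic. -/
def LowerSemianalytic {γ : Type*} [TopologicalSpace γ] (f : γ → EReal) : Prop :=
  ∀ r : ℝ, MeasureTheory.AnalyticSet {x | f x ≤ (r : EReal)}

/-- Lower semianalyticity on a given (analytic) domain. -/
def LowerSemianalyticOn {γ : Type*} [TopologicalSpace γ] (D : Set γ) (f : γ → EReal) : Prop :=
  ∀ r : ℝ, MeasureTheory.AnalyticSet {x | x ∈ D ∧ f x ≤ (r : EReal)}

/-- Upper semianalyticity on a given (analytic) domain. -/
def UpperSemianalyticOn {γ : Type*} [TopologicalSpace γ] (D : Set γ) (f : γ → EReal) : Prop :=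
  ∀ r : ℝ, MeasureTheory.AnalyticSet {x | x ∈ D ∧ (r : EReal) ≤ f x}

/-- The nonnegative part of an extended real number, as an element of `ℝ≥0∞`. -/
def ePos (y : EReal) : ℝ≥0∞ := if y = ⊤ then ⊤ else ENNReal.ofReal y.toReal

/-- The integral `∫ f⁺ dμ - ∫ f⁻ dμ` of an extended-real-valued function, with the
convention `∞ - ∞ = ∞`. -/
def eint {γ : Type*} [MeasurableSpace γ] (μ : Measure γ) (f : γ → EReal) : EReal :=
  if (∫⁻ x, ePos (f x) ∂μ) = ⊤ then ⊤
  else ((∫⁻ x, ePos (f x) ∂μ : ℝ≥0∞) : EReal) - ((∫⁻ x, ePos (-f x) ∂μ : ℝ≥0∞) : EReal)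

/-- Finite sums of extended reals, with the convention `∞ - ∞ = ∞`. -/
def esum {n : ℕ} (v : Fin n → EReal) : EReal :=
  if (∑ i, ePos (v i)) = ⊤ then ⊤
  else ((∑ i, ePos (v i) : ℝ≥0∞) : EReal) - ((∑ i, ePos (-v i) : ℝ≥0∞) : EReal)

/-- The space `H_n = (𝕏 × 𝔸)ⁿ × 𝕏` of histories `h_n = (x_0,a_0,…,x_n)`. -/
abbrev Hist (X A : Type*) (n : ℕ) := (Fin n → X × A) × X

/-- The sample space `Ω = (𝕏 × 𝔸)^∞`. -/
abbrev Traj (X A : Type*) := ℕ → X × A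

/-- The initial state `x_0` of a history. -/
def firstState {X A : Type*} : ∀ {n : ℕ}, Hist X A n → X
  | 0, h => h.2
  | _ + 1, h => (h.1 0).1

/-- A universally measurable policy for the MDP with control constraint `Acts`. -/
structure Policy {X A : Type*} [MeasurableSpace X] [MeasurableSpace A]
    (Acts : X → Set A) where
  μ : ∀ n : ℕ, Hist X A n → Measure A
  isProb : ∀ n h, IsProbabilityMeasure (μ n h)
  umeas : ∀ (n : ℕ) (B : Set A), MeasurableSet B →
    UniversallyMeasurable fun h : Hist X A n => μ n h B
  feasible : ∀ n h, μ n h (Acts h.2) = 1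

namespace Policy

variable {X A : Type*} [MeasurableSpace X] [MeasurableSpace A] {Acts : X → Set A}

/-- Nonrandomized policies: every decision is a Dirac measure. -/
def Nonrandomized (π : Policy Acts) : Prop :=
  ∀ n h, ∃ a : A, π.μ n h = Measure.dirac a

/-- Markov policies: the decision depends only on the current state. -/
def Markov (π : Policy Acts) : Prop :=
  ∃ m : ℕ → X → Measure A, ∀ n h, π.μ n h = m n h.2

/-- Stationary policies. -/
def Stationary (π : Policy Acts) : Prop :=
  ∃ m : X → Measure A, ∀ n h, π.μ n h = m h.2

/-- Semi-Markov policies: the decision depends only on `(x_0, x_n)`. -/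
def SemiMarkov (π : Policy Acts) : Prop :=
  ∃ m : ℕ → X × X → Measure A, ∀ n h, π.μ n h = m n (firstState h, h.2)

/-- Semi-stationary policies. -/
def SemiStationary (π : Policy Acts) : Prop :=
  ∃ m : X × X → Measure A, ∀ n h, π.μ n h = m (firstState h, h.2)

end Policy

variable {X A : Type*} [MeasurableSpace X] [MeasurableSpace A]

/-- The iterated integral giving the finite-dimensional distributions of the process
induced by an initial distribution, the transition kernel and a policy. -/
def histInt (p0 : Measure X) (q : Kernel (X × A) X)
    (ν : ∀ n : ℕ, Hist X A n → Measure A) :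
    ∀ n : ℕ, (Hist X A n → ℝ≥0∞) → ℝ≥0∞
  | 0, f => ∫⁻ x, f (Fin.elim0, x) ∂p0
  | n + 1, f => histInt p0 q ν n fun h =>
      ∫⁻ a, ∫⁻ y, f (Fin.snoc h.1 (h.2, a), y) ∂(q (h.2, a)) ∂(ν n h)

/-- `Induces q π p0 p` says that `p` is (the restriction to the Borel σ-algebra of) the
strategic measure `ρ_{p0}[π]`, i.e. `p` has the finite-dimensional distributions generated
by `p0`, the policy `π`, and the transition kernel `q`. -/
def Induces (q : Kernel (X × A) X) {Acts : X → Set A} (π : Policy Acts)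
    (p0 : Measure X) (p : Measure (Traj X A)) : Prop :=
  ∀ (n : ℕ) (B : Set (Hist X A n)), MeasurableSet B →
    p {ω : Traj X A | ((fun i : Fin n => ω i.val), (ω n).1) ∈ B}
      = histInt p0 q π.μ n (B.indicator fun _ => 1)

/-- The set of strategic measures induced by policies in the class `C` (over all initial
distributions). -/
def SOf (q : Kernel (X × A) X) (Acts : X → Set A) (C : Policy Acts → Prop) :
    Set (ProbabilityMeasure (Traj X A)) :=
  {p | ∃ (π : Policy Acts) (p0 : ProbabilityMeasure X),
    C π ∧ Induces q π p0.toMeasure p.toMeasure}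

variable [TopologicalSpace X] [BorelSpace X] [TopologicalSpace A] [BorelSpace A]

/-- The section `tilde-S_⋆(x)`: strategic measures in the class with initial distribution `δ_x`. -/
def tsec (q : Kernel (X × A) X) (Acts : X → Set A) (C : Policy Acts → Prop) (x : X) :
    Set (ProbabilityMeasure (Traj X A)) :=
  {p | p ∈ SOf q Acts C ∧ p.toMeasure.map (fun ω => (ω 0).1) = Measure.dirac x}

/-- The set `tilde-S_⋆ ⊂ 𝕏 × P(Ω)`. -/
def tset (q : Kernel (X × A) X) (Acts : X → Set A) (C : Policy Acts → Prop) :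
    Set (X × ProbabilityMeasure (Traj X A)) :=
  {xp | xp.2 ∈ tsec q Acts C xp.1}

end PaperStmt

namespace PaperStmt

/-- An analytic set has compact subsets of measure arbitrarily close to its own: every `r` below
the outer measure of the range of `F` is a lower bound for the measure of the image of some
compact box. -/
theorem exists_isCompact_le_measure_image {α : Type*} [TopologicalSpace α] [MeasurableSpace α]
    (μ : Measure α) [μ.OuterRegular] {F : (ℕ → ℕ) → α} (hF : Continuous F)
    {r : ℝ≥0∞} (hr : r < μ (Set.range F)) :
    ∃ K : Set (ℕ → ℕ), IsCompact K ∧ r ≤ μ (F '' K) := by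
  have step : ∀ (D : Set (ℕ → ℕ)) (k : ℕ), ∃ m : ℕ, r < μ (F '' D) →
      r < μ (F '' (D ∩ {σ | σ k ≤ m})) := by
    intro D k
    by_cases h : r < μ (F '' D)
    · have hmono : Monotone fun m : ℕ => F '' (D ∩ {σ | σ k ≤ m}) := fun a b hab =>
        Set.image_mono (Set.inter_subset_inter_right _ fun σ (hσ : σ k ≤ a) => hσ.trans hab)
      have hU : F '' D = ⋃ m : ℕ, F '' (D ∩ {σ | σ k ≤ m}) := by
        rw [← Set.image_iUnion, ← Set.inter_iUnion]
        congr 1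
        ext σ
        simpa using fun _ => ⟨σ k, le_rfl⟩
      rw [hU, hmono.measure_iUnion, lt_iSup_iff] at h
      exact h.imp fun m hm _ => hm
    · exact ⟨0, fun h' => absurd h' h⟩
  choose m hm using step
  let D : ℕ → Set (ℕ → ℕ) := fun k =>
    Nat.rec Set.univ (fun k D => D ∩ {σ | σ k ≤ m D k}) k
  have hDr : ∀ k, r < μ (F '' D k) := by
    intro k
    induction k with
    | zero => simpa [D, Set.image_univ] using hr
    | succ k ih => exact hm _ _ ih
  let b : ℕ → ℕ := fun k => m (D k) k
  have hDb : ∀ k, ∀ σ ∈ D k, ∀ i < k, σ i ≤ b i := by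
    intro k
    induction k with
    | zero => intro σ _ i hi; omega
    | succ k ih =>
      intro σ hσ i hi
      rcases Nat.lt_succ_iff_lt_or_eq.1 hi with h | rfl
      · exact ih σ hσ.1 i h
      · exact hσ.2
  have hK : IsCompact (Set.univ.pi fun i => Set.Iic (b i)) :=
    isCompact_univ_pi fun i => (Set.finite_Iic (b i)).isCompact
  refine ⟨_, hK, ?_⟩
  rw [Set.measure_eq_iInf_isOpen]
  refine le_iInf fun U => le_iInf fun hKU => le_iInf fun hU => ?_
  suffices h : ∃ k, F '' D k ⊆ U by
    obtain ⟨k, hk⟩ := h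
    exact (hDr k).le.trans (measure_mono hk)
  by_contra! hcon
  simp only [Set.not_subset, Set.exists_mem_image] at hcon
  choose σ hσD hσU using hcon
  obtain ⟨τ, hτ, φ, hφ, hlim⟩ := hK.tendsto_subseq (x := fun k i => min (σ k i) (b i))
    fun k i _ => min_le_right (σ k i) (b i)
  have hlim' : Tendsto (fun k => σ (φ k)) atTop (𝓝 τ) := by
    rw [tendsto_pi_nhds] at hlim ⊢
    intro i
    refine (hlim i).congr' ?_
    filter_upwards [hφ.tendsto_atTop.eventually_gt_atTop i] with k hk
    exact min_eq_left (hDb _ _ (hσD _) i hk)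
  have hev := ((hF.tendsto τ).comp hlim').eventually
    (hU.mem_nhds (hKU (Set.mem_image_of_mem F hτ)))
  obtain ⟨k, hk⟩ := hev.exists
  exact hσU _ hk

/-- Analytic sets are measurable with respect to the completion of every finite Borel measure. -/
theorem nullMeasurableSet_of_analyticSet {α : Type*} [TopologicalSpace α] [PolishSpace α]
    [MeasurableSpace α] [BorelSpace α] {s : Set α} (hs : MeasureTheory.AnalyticSet s)
    (μ : Measure α) [IsFiniteMeasure μ] : NullMeasurableSet s μ := by
  let := TopologicalSpace.upgradeIsCompletelyMetrizable α
  rw [AnalyticSet] at hs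
  obtain rfl | ⟨F, hF, rfl⟩ := hs
  · exact MeasurableSet.empty.nullMeasurableSet
  obtain h0 | h0 := eq_or_ne (μ (Set.range F)) 0
  · exact NullMeasurableSet.of_null h0
  obtain ⟨u, -, hu, hlim⟩ := exists_seq_strictMono_tendsto' (pos_iff_ne_zero.2 h0)
  choose K hK hKu using fun n => exists_isCompact_le_measure_image μ hF (hu n).2
  have hT : MeasurableSet (⋃ n, F '' K n) :=
    MeasurableSet.iUnion fun n => ((hK n).image hF).measurableSet
  refine hT.nullMeasurableSet.congr (ae_eq_of_subset_of_measure_ge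
    (Set.iUnion_subset fun n => Set.image_subset_range _ _) ?_ hT.nullMeasurableSet
    (measure_ne_top _ _))
  exact le_of_tendsto' hlim fun n => (hKu n).trans (measure_mono (Set.subset_iUnion (fun n => F '' K n) n))

/-- The σ-algebra of universally measurable sets. -/
@[reducible] def univMeasurableSpace (α : Type*) [MeasurableSpace α] : MeasurableSpace α where
  MeasurableSet' := UniversallyMeasurableSet
  measurableSet_empty _ _ := MeasurableSet.empty.nullMeasurableSet
  measurableSet_compl _ hs μ hμ := (hs μ hμ).compl
  measurableSet_iUnion _ hs μ hμ := NullMeasurableSet.iUnion fun i => hs i μ hμ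

theorem le_univMeasurableSpace {α : Type*} [m : MeasurableSpace α] : m ≤ univMeasurableSpace α :=
  fun _ hs _ _ => MeasurableSet.nullMeasurableSet hs

/-- A universally measurable map into a countably generated space is measurable with respect to
the σ-algebras of universally measurable sets on both sides. -/
theorem UniversallyMeasurable.preimage {α β : Type*} [MeasurableSpace α] [MeasurableSpace β]
    [MeasurableSpace.CountablyGenerated β] {f : α → β} (hf : UniversallyMeasurable f)
    {s : Set β} (hs : UniversallyMeasurableSet s) : UniversallyMeasurableSet (f ⁻¹' s) := by
  intro μ hμ
  have hfm : AEMeasurable f μ := NullMeasurable.aemeasurable fun t ht => hf t ht μ hμ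
  have := Measure.isProbabilityMeasure_map hfm
  have hnull := hs (μ.map f) this
  rw [Measure.map_congr hfm.ae_eq_mk] at hnull
  refine (hnull.preimage (hfm.measurable_mk.quasiMeasurePreserving μ)).congr ?_
  filter_upwards [hfm.ae_eq_mk] with x hx
  exact congrArg s hx.symm

theorem _root_.Measurable.univMeasurable {α β : Type*} [MeasurableSpace α] [MeasurableSpace β]
    {f : α → β} (hf : Measurable f) :
    @Measurable α β (univMeasurableSpace α) (univMeasurableSpace β) f := by
  intro s hs μ hμ
  have := Measure.isProbabilityMeasure_map hf.aemeasurable (μ := μ)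
  exact (hs (μ.map f) this).preimage (hf.quasiMeasurePreserving μ)

/-- **Measurable selection**: a closed-valued multifunction into the Baire space for which the
sets of points whose values meet a given open set are measurable has a measurable selector
(the lexicographically least element). -/
theorem exists_measurable_selector_baire {α : Type*} [MeasurableSpace α] (C : α → Set (ℕ → ℕ))
    (hne : ∀ x, (C x).Nonempty) (hcl : ∀ x, IsClosed (C x))
    (hmeas : ∀ U, IsOpen U → MeasurableSet {x | (C x ∩ U).Nonempty}) :
    ∃ σ : α → ℕ → ℕ, Measurable σ ∧ ∀ x, σ x ∈ C x := by
  let D : ℕ → α → Set (ℕ → ℕ) := fun k =>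
    Nat.rec C (fun k D x => {τ ∈ D x | τ k = sInf ((fun ρ => ρ k) '' D x)}) k
  let σ : α → ℕ → ℕ := fun x k => sInf ((fun ρ : ℕ → ℕ => ρ k) '' D k x)
  have hDsucc : ∀ k x, D (k + 1) x = {τ ∈ D k x | τ k = σ x k} := fun _ _ => rfl
  have hDne : ∀ k x, (D k x).Nonempty := by
    intro k
    induction k with
    | zero => exact hne
    | succ k ih =>
      intro x
      obtain ⟨τ, hτ, h⟩ := Nat.sInf_mem ((ih x).image fun ρ : ℕ → ℕ => ρ k)
      exact ⟨τ, hτ, h⟩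
  have hDσ : ∀ k x, ∀ τ ∈ D k x, τ ∈ C x ∧ ∀ i < k, τ i = σ x i := by
    intro k x
    induction k with
    | zero => exact fun τ hτ => ⟨hτ, fun i hi => by omega⟩
    | succ k ih =>
      intro τ hτ
      refine ⟨(ih τ hτ.1).1, fun i hi => ?_⟩
      rcases Nat.lt_succ_iff_lt_or_eq.1 hi with h | rfl
      · exact (ih τ hτ.1).2 i h
      · exact hτ.2
  have hopen : ∀ k j : ℕ, IsOpen {τ : ℕ → ℕ | τ k = j} := fun k j =>
    (isOpen_discrete ({j} : Set ℕ)).preimage (continuous_apply (A := fun _ => ℕ) k)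
  have hσk : ∀ k, (∀ U, IsOpen U → MeasurableSet {x | (D k x ∩ U).Nonempty}) →
      ∀ j, MeasurableSet {x | σ x k = j} := by
    intro k hk j
    have : {x | σ x k = j} = {x | (D k x ∩ {τ | τ k = j}).Nonempty} \
        ⋃ i : Fin j, {x | (D k x ∩ {τ | τ k = i}).Nonempty} := by
      ext x
      simp only [Set.mem_sdiff, Set.mem_iUnion, Set.mem_ofPred_eq, not_exists]
      constructor
      · rintro rfl
        refine ⟨?_, ?_⟩
        · obtain ⟨τ, hτ⟩ := hDne (k + 1) x
          exact ⟨τ, hτ⟩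
        · rintro i ⟨τ, hτ, hi⟩
          have : σ x k ≤ τ k := Nat.sInf_le ⟨τ, hτ, rfl⟩
          have hi : τ k = i := hi
          omega
      · rintro ⟨⟨τ, hτ, hj⟩, h⟩
        have hle : σ x k ≤ τ k := Nat.sInf_le ⟨τ, hτ, rfl⟩
        have hj : τ k = j := hj
        by_contra hneq
        obtain ⟨ρ, hρ⟩ := hDne (k + 1) x
        exact h ⟨σ x k, by omega⟩ ⟨ρ, hρ⟩
    rw [this]
    exact (hk _ (hopen k j)).diff (MeasurableSet.iUnion fun i => hk _ (hopen k i))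
  have hDm : ∀ k U, IsOpen U → MeasurableSet {x | (D k x ∩ U).Nonempty} := by
    intro k
    induction k with
    | zero => exact hmeas
    | succ k ih =>
      intro U hU
      have : {x | (D (k + 1) x ∩ U).Nonempty} =
          ⋃ j, {x | σ x k = j} ∩ {x | (D k x ∩ ({τ | τ k = j} ∩ U)).Nonempty} := by
        ext x
        simp only [Set.mem_iUnion, Set.mem_inter_iff, Set.mem_ofPred_eq, exists_eq_left']
        rw [hDsucc, ← Set.inter_assoc]
        rfl
      rw [this]
      exact MeasurableSet.iUnion fun j =>
        (hσk k ih j).inter (ih _ ((hopen k j).inter hU))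
  refine ⟨σ, measurable_pi_lambda _ fun k => measurable_to_countable' fun j => hσk k (hDm k) j,
    fun x => ?_⟩
  choose τ hτ using fun k => hDne k x
  refine (hcl x).mem_of_tendsto (b := atTop) (f := τ) ?_
    (Eventually.of_forall fun k => (hDσ k x _ (hτ k)).1)
  rw [tendsto_pi_nhds]
  intro i
  refine tendsto_const_nhds.congr' ?_
  filter_upwards [eventually_gt_atTop i] with k hk
  exact ((hDσ k x _ (hτ k)).2 i hk).symm

/-- **Jankov–von Neumann**: an analytic set with nonempty sections has a universally measurable
uniformization. -/
theorem exists_universallyMeasurable_selector {X A : Type*}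
    [TopologicalSpace X] [PolishSpace X] [MeasurableSpace X] [BorelSpace X]
    [TopologicalSpace A] [MeasurableSpace A] [BorelSpace A]
    (Acts : X → Set A) (hne : ∀ x, (Acts x).Nonempty)
    (hΓ : MeasureTheory.AnalyticSet {xa : X × A | xa.2 ∈ Acts xa.1}) :
    ∃ φ : X → A, UniversallyMeasurable φ ∧ ∀ x, φ x ∈ Acts x := by
  rw [AnalyticSet] at hΓ
  obtain h | ⟨F, hF, hrange⟩ := hΓ
  · have hX : IsEmpty X := ⟨fun x =>
      (Set.eq_empty_iff_forall_notMem.1 h (x, (hne x).some)) (hne x).some_mem⟩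
    exact ⟨fun x => (hne x).some, fun s _ μ hμ => (Set.toFinite _).measurableSet.nullMeasurableSet,
      fun x => isEmptyElim x⟩
  have hF1 : Continuous fun σ => (F σ).1 := continuous_fst.comp hF
  obtain ⟨σ, hσ, hσC⟩ := @exists_measurable_selector_baire X (univMeasurableSpace X)
    (fun x => {σ | (F σ).1 = x}) (fun x => by
      have hx : (x, (hne x).some) ∈ Set.range F := hrange ▸ (hne x).some_mem
      obtain ⟨σ, h⟩ := hx
      exact ⟨σ, congrArg Prod.fst h⟩)
    (fun x => isClosed_singleton.preimage hF1)
    (fun U hU μ hμ => by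
      convert nullMeasurableSet_of_analyticSet (hU.analyticSet_image hF1) μ using 1
      ext x
      exact ⟨fun ⟨σ, h, hσ⟩ => ⟨σ, hσ, h⟩, fun ⟨σ, hσ, h⟩ => ⟨σ, h, hσ⟩⟩)
  refine ⟨fun x => (F (σ x)).2, fun s hs =>
    hσ ((continuous_snd.comp hF).measurable hs), fun x => ?_⟩
  have hx : F (σ x) ∈ {xa : X × A | xa.2 ∈ Acts xa.1} := hrange ▸ Set.mem_range_self _
  have h1 : (F (σ x)).1 = x := hσC x
  simpa [h1] using hx

/-- A measurably parametrized family of probability measures on a standard Borel space is the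
family of images of the uniform distribution under a jointly measurable map. -/
theorem exists_measurable_map_volume_eq {H A : Type*} [MeasurableSpace H] [MeasurableSpace A]
    [StandardBorelSpace A] [Nonempty A] (ν : H → Measure A) (hp : ∀ h, IsProbabilityMeasure (ν h))
    (hν : ∀ B, MeasurableSet B → Measurable fun h => ν h B) :
    ∃ g : H → unitInterval → A, Measurable (Function.uncurry g) ∧
      ∀ h, (volume : Measure unitInterval).map (g h) = ν h := by
  let κ : Kernel H A := ⟨ν, Measure.measurable_of_measurable_coe _ hν⟩
  have : IsMarkovKernel κ := ⟨hp⟩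
  exact κ.exists_measurable_map_eq_unitInterval

/-- A universally measurable stochastic kernel concentrated on the sections of an analytic set is
the image of the uniform distribution under a universally measurable map with values in these
sections. -/
theorem exists_universallyMeasurable_representation {X A H : Type*}
    [TopologicalSpace X] [PolishSpace X] [MeasurableSpace X] [BorelSpace X]
    [TopologicalSpace A] [PolishSpace A] [MeasurableSpace A] [BorelSpace A] [MeasurableSpace H]
    (Acts : X → Set A) (hne : ∀ x, (Acts x).Nonempty)
    (hΓ : MeasureTheory.AnalyticSet {xa : X × A | xa.2 ∈ Acts xa.1})
    {p : H → X} (hpm : Measurable p) (ν : H → Measure A) (hν : ∀ h, IsProbabilityMeasure (ν h))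
    (hum : ∀ B, MeasurableSet B → UniversallyMeasurable fun h => ν h B)
    (hfeas : ∀ h, ν h (Acts (p h)) = 1) :
    ∃ f : unitInterval × H → A, UniversallyMeasurable f ∧ ∀ h,
      (∀ θ, f (θ, h) ∈ Acts (p h)) ∧
      ∀ B, MeasurableSet B → ν h B = volume {θ : unitInterval | f (θ, h) ∈ B} := by
  classical
  obtain ⟨φ, hφ, hφA⟩ := exists_universallyMeasurable_selector Acts hne hΓ
  cases isEmpty_or_nonempty H with
  | inl hH =>
    exact ⟨fun q => φ (p q.2), fun s _ μ _ => (Set.toFinite _).measurableSet.nullMeasurableSet,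
      fun h => isEmptyElim h⟩
  | inr hH =>
  have hA : Nonempty A := hH.map (φ ∘ p)
  obtain ⟨g, hg, hgν⟩ := @exists_measurable_map_volume_eq H A (univMeasurableSpace H) _ _ _ ν hν hum
  have hΓu : UniversallyMeasurableSet {xa : X × A | xa.2 ∈ Acts xa.1} := fun μ _ =>
    nullMeasurableSet_of_analyticSet hΓ μ
  have hgθ : ∀ h, Measurable (g h) := fun h =>
    hg.comp (@measurable_prodMk_left H unitInterval (univMeasurableSpace H) _ h)
  have hG : @Measurable (unitInterval × H) A (univMeasurableSpace _) _ fun q => g q.2 q.1 :=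
    @Measurable.comp _ _ _ (univMeasurableSpace _)
      (@Prod.instMeasurableSpace _ _ (univMeasurableSpace H) _) _ _ _ hg
      (@Measurable.prodMk _ (univMeasurableSpace _) _ _ (univMeasurableSpace H) _ _ _
      measurable_snd.univMeasurable (measurable_fst.mono le_univMeasurableSpace le_rfl))
  have hpq : Measurable fun q : unitInterval × H => p q.2 := hpm.comp measurable_snd
  have hpG : UniversallyMeasurable fun q : unitInterval × H => (p q.2, g q.2 q.1) :=
    @Measurable.prodMk _ (univMeasurableSpace _) _ _ _ _ _ _
      (hpq.mono le_univMeasurableSpace le_rfl) hG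
  have hS : MeasurableSet[univMeasurableSpace _]
      {q : unitInterval × H | g q.2 q.1 ∈ Acts (p q.2)} := hpG.preimage hΓu
  have hφp : @Measurable _ _ (univMeasurableSpace _) _ fun q : unitInterval × H => φ (p q.2) :=
    @Measurable.comp _ _ _ (univMeasurableSpace _) (univMeasurableSpace _) _ _ _ hφ
      hpq.univMeasurable
  refine ⟨fun q => if g q.2 q.1 ∈ Acts (p q.2) then g q.2 q.1 else φ (p q.2),
    @Measurable.ite _ _ _ _ (univMeasurableSpace _) _
      (fun q : unitInterval × H => g q.2 q.1 ∈ Acts (p q.2)) _ hS hG hφp, fun h => ⟨fun θ => ?_, fun B hB => ?_⟩⟩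
  · dsimp only
    split_ifs with hθ
    exacts [hθ, hφA _]
  · have hAu : NullMeasurableSet (Acts (p h)) (ν h) :=
      (measurable_prodMk_left (x := p h)).univMeasurable hΓu _ (hν h)
    have hnull : ν h (Acts (p h))ᶜ = 0 := by
      have := hν h
      exact (prob_compl_eq_zero_iff₀ hAu).2 (hfeas h)
    rw [← hgν h] at hnull
    have hae : ∀ᵐ θ : unitInterval, g h θ ∈ Acts (p h) :=
      ae_of_ae_map (hgθ h).aemeasurable hnull
    rw [← hgν h, Measure.map_apply (hgθ h) hB]
    refine measure_congr ?_
    filter_upwards [hae] with θ hθ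
    change (g h θ ∈ B) = ((if g h θ ∈ Acts (p h) then g h θ else φ (p h)) ∈ B)
    rw [if_pos hθ]

/-- Lemma `lem-nonrand1`: for each policy `π = (μ_0, μ_1, …)` there are
universally measurable functions `f_n : [0,1] × H_n → 𝔸` such that `f_n(θ, h_n) ∈ A(x_n)`
for every `θ`, and `μ_n(· | h_n)` is the image of Lebesgue measure on `[0,1]` under
`θ ↦ f_n(θ, h_n)`. -/
theorem statement7
    {X A : Type*} [TopologicalSpace X] [PolishSpace X] [MeasurableSpace X] [BorelSpace X]
    [TopologicalSpace A] [PolishSpace A] [MeasurableSpace A] [BorelSpace A]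
    (Acts : X → Set A) (hne : ∀ x, (Acts x).Nonempty)
    (hΓ : MeasureTheory.AnalyticSet {xa : X × A | xa.2 ∈ Acts xa.1})
    (π : Policy Acts) :
    ∃ f : ∀ n : ℕ, unitInterval × Hist X A n → A,
      (∀ n, UniversallyMeasurable (f n)) ∧
      ∀ (n : ℕ) (h : Hist X A n),
        (∀ θ : unitInterval, f n (θ, h) ∈ Acts h.2) ∧
        ∀ B : Set A, MeasurableSet B →
          π.μ n h B = volume (Subtype.val '' {θ : unitInterval | f n (θ, h) ∈ B}) := by
  choose f hf hfA using fun n => exists_universallyMeasurable_representation Acts hne hΓ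
    (measurable_snd : Measurable fun h : Hist X A n => h.2) (π.μ n) (π.isProb n) (π.umeas n)
    (π.feasible n)
  refine ⟨f, hf, fun n h => ⟨(hfA n h).1, fun B hB => ?_⟩⟩
  rw [(hfA n h).2 B hB]
  exact (volume_image_subtype_coe measurableSet_Icc _).symm

end PaperStmt
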